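/- Let m, n ∈ ℕ with m ≥ 2 and n ≥ 2 both odd. Then the Tornheim double series satisfies T(m,0,n) = ζ(m) ζ(n) − (1/2) ζ(m+n) + (−1)^{⌊(m+n)/2⌋} ((2π)^{m+n−1}/(m! n!)) · ( m·I_AB(n,m−1) + n·I_AB(n−1,m) ). -/

import Mathlib

open Real MeasureTheory

/-- Hurwitz zeta as a real-valued function of real arguments. -/
noncomputable def hzeta (z q : ℝ) : ℝ := (HurwitzZeta.hurwitzZeta (q : UnitAddCircle) (z : ℂ)).re

/-- Riemann zeta as a real-valued function of a real argument. -/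
noncomputable def rzeta (s : ℝ) : ℝ := (riemannZeta (s : ℂ)).re

/-- Tornheim double series. -/
noncomputable def T (a b c : ℝ) : ℝ :=
  ∑' r : ℕ+, ∑' s : ℕ+, 1 / ((r : ℝ) ^ a * (s : ℝ) ^ b * ((r : ℝ) + (s : ℝ)) ^ c)

/-- Bernoulli polynomial evaluated at a real. -/
noncomputable def B (k : ℕ) (q : ℝ) : ℝ := Polynomial.aeval q (Polynomial.bernoulli k)

/-- The Bernoulli function `A_k(q) = k ζ'(1-k, q)`. -/
noncomputable def A (k : ℕ) (q : ℝ) : ℝ :=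
  k * (deriv (fun z : ℂ => HurwitzZeta.hurwitzZeta (q : UnitAddCircle) z) (1 - (k : ℂ))).re

/-- The kernel `K(q) = log sin (π q)`. -/
noncomputable def K (q : ℝ) : ℝ := Real.log (Real.sin (π * q))

noncomputable def I_AB (k l : ℕ) : ℝ := (1 / π) * ∫ q in (0:ℝ)..1, A k q * B l q * K q

noncomputable def I_BB (k l : ℕ) : ℝ := ∫ q in (0:ℝ)..1, B k q * B l q * K q

noncomputable def I_AA (k l : ℕ) : ℝ := (1 / π ^ 2) * ∫ q in (0:ℝ)..1, A k q * A l q * K q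

noncomputable def J_AA (k l : ℕ) : ℝ := (1 / π ^ 2) * ∫ q in (0:ℝ)..1, A k q * A l (1 - q) * K q

lemma intervalIntegrable_K : IntervalIntegrable K volume 0 1 := by
  have h := (intervalIntegrable_log_sin (a := 0) (b := π)).comp_mul_left (c := π)
  have h2 : π / π = 1 := div_self pi_ne_zero
  simpa [h2, K, Function.comp_def] using! h

lemma intervalIntegrable_mul_K {f : ℝ → ℝ} (hf : Continuous f) :
    IntervalIntegrable (fun q => f q * K q) volume 0 1 :=
  intervalIntegrable_K.continuousOn_mul hf.continuousOn

lemma integral_cos_two_pi_mul_nat (N : ℕ) (hN : N ≠ 0) :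
    ∫ q in (0:ℝ)..1, cos (2 * π * N * q) = 0 := by
  have h0 : 2 * π * N ≠ 0 := by positivity
  rw [intervalIntegral.integral_comp_mul_left (fun x => cos x) h0, integral_cos]
  have : sin (2 * π * N * 1) = 0 := by
    rw [mul_one, mul_comm (2 * π)]
    simpa using Real.sin_nat_mul_two_pi_sub 0 N
  rw [this]
  simp

/-- The weighted cosine moments of the kernel `K` differ by an elementary integral. -/
lemma cos_moment_K_succ (N : ℕ) :
    ∫ q in (0:ℝ)..1, (2 * π * ((N + 1) * cos (2 * π * (N + 1 : ℕ) * q)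
        - N * cos (2 * π * N * q)) * K q
      + π * (cos (2 * π * (N + 1 : ℕ) * q) + cos (2 * π * N * q))) = 0 := by
  have key := intervalIntegral.integral_eq_sub_of_hasDerivAt_of_le
    (f := fun q => 2 * cos ((2 * N + 1) * π * q) * (sin (π * q) * log (sin (π * q))))
    (f' := fun q => 2 * π * ((N + 1) * cos (2 * π * (N + 1 : ℕ) * q)
        - N * cos (2 * π * N * q)) * K q
      + π * (cos (2 * π * (N + 1 : ℕ) * q) + cos (2 * π * N * q)))
    (a := 0) (b := 1) zero_le_one ?_ ?_ ?_
  · rw [key]; simp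
  · apply Continuous.continuousOn
    have : Continuous fun q : ℝ => sin (π * q) * log (sin (π * q)) :=
      Real.continuous_mul_log.comp (by fun_prop : Continuous fun q : ℝ => sin (π * q))
    fun_prop
  · intro q hq
    have hs : 0 < sin (π * q) := by
      apply sin_pos_of_pos_of_lt_pi
      · exact mul_pos pi_pos hq.1
      · nlinarith [pi_pos, hq.2]
    have h1 : HasDerivAt (fun q : ℝ => π * q) π q := by
      simpa using (hasDerivAt_id q).const_mul π
    have h2 : HasDerivAt (fun q : ℝ => (2 * N + 1) * π * q) ((2 * N + 1) * π) q := by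
      simpa using (hasDerivAt_id q).const_mul ((2 * N + 1) * π)
    have h3 := (h2.cos.const_mul 2).mul (h1.sin.mul (h1.sin.log hs.ne'))
    refine h3.congr_deriv ?_
    have c1 : cos (2 * π * (N + 1 : ℕ) * q) = cos ((2 * N + 1) * π * q) * cos (π * q)
        - sin ((2 * N + 1) * π * q) * sin (π * q) := by
      rw [← cos_add]; congr 1; push_cast; ring
    have c2 : cos (2 * π * N * q) = cos ((2 * N + 1) * π * q) * cos (π * q)
        + sin ((2 * N + 1) * π * q) * sin (π * q) := by
      rw [← cos_sub]; congr 1; ring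
    rw [c1, c2, K]
    simp only [Pi.mul_apply]
    field_simp
    ring
  · apply IntervalIntegrable.add
    · apply intervalIntegrable_mul_K; fun_prop
    · apply Continuous.intervalIntegrable; fun_prop

lemma cos_moment_K (N : ℕ) :
    ((N + 1 : ℕ) : ℝ) * ∫ q in (0:ℝ)..1, cos (2 * π * (N + 1 : ℕ) * q) * K q = -(1 / 2) := by
  have hi (M : ℕ) : IntervalIntegrable (fun q => cos (2 * π * M * q) * K q) volume 0 1 :=
    intervalIntegrable_mul_K (by fun_prop)
  have hc (M : ℕ) : IntervalIntegrable (fun q => cos (2 * π * M * q)) volume 0 1 :=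
    Continuous.intervalIntegrable (by fun_prop) _ _
  have step (M : ℕ) : 2 * π * (((M + 1 : ℕ) : ℝ) *
        (∫ q in (0:ℝ)..1, cos (2 * π * (M + 1 : ℕ) * q) * K q)
        - M * ∫ q in (0:ℝ)..1, cos (2 * π * M * q) * K q)
      + π * ((∫ q in (0:ℝ)..1, cos (2 * π * (M + 1 : ℕ) * q))
        + ∫ q in (0:ℝ)..1, cos (2 * π * M * q)) = 0 := by
    refine Eq.trans ?_ (cos_moment_K_succ M)
    rw [← intervalIntegral.integral_add (hc _) (hc _),
      ← intervalIntegral.integral_const_mul, ← intervalIntegral.integral_const_mul,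
      ← intervalIntegral.integral_const_mul,
      ← intervalIntegral.integral_sub ((hi _).const_mul _) ((hi _).const_mul _),
      ← intervalIntegral.integral_const_mul,
      ← intervalIntegral.integral_add ((((hi _).const_mul _).sub ((hi _).const_mul _)).const_mul _)
        (((hc _).add (hc _)).const_mul _)]
    congr 1
    ext q
    push_cast
    ring
  induction N with
  | zero =>
    have h := step 0
    rw [integral_cos_two_pi_mul_nat _ (Nat.succ_ne_zero 0)] at h
    have hp := pi_pos
    simp only [Nat.cast_zero, mul_zero, zero_mul, cos_zero, intervalIntegral.integral_const,
      sub_zero, smul_eq_mul, mul_one, zero_add, Nat.cast_one] at h ⊢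
    apply mul_left_cancel₀ (show 2 * π ≠ 0 by positivity)
    linarith
  | succ N ih =>
    have h := step (N + 1)
    rw [integral_cos_two_pi_mul_nat _ (Nat.succ_ne_zero _),
      integral_cos_two_pi_mul_nat _ (Nat.succ_ne_zero _)] at h
    have hp := pi_pos
    apply mul_left_cancel₀ (show 2 * π ≠ 0 by positivity)
    rw [ih] at h
    linarith

lemma int_cos_moment_K (N : ℤ) :
    (N : ℝ) * ∫ q in (0:ℝ)..1, cos (2 * π * N * q) * K q = -((N.sign : ℤ) : ℝ) / 2 := by
  rcases lt_trichotomy N 0 with h | h | h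
  · obtain ⟨M, hM⟩ : ∃ M : ℕ, N = -((M + 1 : ℕ) : ℤ) := ⟨(-N - 1).toNat, by omega⟩
    have := cos_moment_K M
    rw [Int.sign_eq_neg_one_of_neg h, hM]
    have e (q : ℝ) : cos (2 * π * ((-((M + 1 : ℕ) : ℤ) : ℤ) : ℝ) * q)
        = cos (2 * π * (M + 1 : ℕ) * q) := by
      rw [← cos_neg]; congr 1; push_cast; ring
    simp only [e]
    push_cast at this ⊢
    linarith
  · simp [h]
  · obtain ⟨M, hM⟩ : ∃ M : ℕ, N = ((M + 1 : ℕ) : ℤ) := ⟨(N - 1).toNat, by omega⟩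
    have := cos_moment_K M
    rw [Int.sign_eq_one_of_pos h, hM]
    push_cast at this ⊢
    linarith

/-- The kernel moments of `r cos cos - s sin sin`, which is the derivative of `sin cos`. -/
lemma cos_cos_sub_sin_sin_moment_K (r s : ℕ) (h : 0 < r + s) :
    ∫ q in (0:ℝ)..1, (r * (cos (2 * π * r * q) * cos (2 * π * s * q))
        - s * (sin (2 * π * r * q) * sin (2 * π * s * q))) * K q
      = -(1 + (((r : ℤ) - s).sign : ℝ)) / 4 := by
  have h1 := int_cos_moment_K (r + s)
  have h2 := int_cos_moment_K (r - s)
  rw [Int.sign_eq_one_of_pos (by omega)] at h1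
  rw [← intervalIntegral.integral_const_mul] at h1 h2
  have i1 : IntervalIntegrable (fun q => (((r + s : ℤ) : ℤ) : ℝ) *
      (cos (2 * π * ((r + s : ℤ) : ℤ) * q) * K q)) volume 0 1 :=
    (intervalIntegrable_mul_K (by fun_prop)).const_mul _
  have i2 : IntervalIntegrable (fun q => (((r - s : ℤ) : ℤ) : ℝ) *
      (cos (2 * π * ((r - s : ℤ) : ℤ) * q) * K q)) volume 0 1 :=
    (intervalIntegrable_mul_K (by fun_prop)).const_mul _
  have : -(1 + (((r : ℤ) - s).sign : ℝ)) / 4 = (1 / 2) *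
      (-((1 : ℤ) : ℝ) / 2 + -((((r : ℤ) - s).sign : ℤ) : ℝ) / 2) := by push_cast; ring
  rw [this, ← h1, ← h2, ← intervalIntegral.integral_add i1 i2,
    ← intervalIntegral.integral_const_mul]
  congr 1
  ext q
  have c1 : cos (2 * π * ((r + s : ℤ) : ℤ) * q) = cos (2 * π * r * q) * cos (2 * π * s * q)
      - sin (2 * π * r * q) * sin (2 * π * s * q) := by
    rw [← cos_add]; congr 1; push_cast; ring
  have c2 : cos (2 * π * ((r - s : ℤ) : ℤ) * q) = cos (2 * π * r * q) * cos (2 * π * s * q)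
      + sin (2 * π * r * q) * sin (2 * π * s * q) := by
    rw [← cos_sub]; congr 1; push_cast; ring
  rw [c1, c2]
  push_cast
  ring

lemma abscissaOfAbsConv_exp_le_one (q : ℝ) :
    LSeries.abscissaOfAbsConv (fun n : ℕ => Complex.exp (2 * π * Complex.I * q * n)) ≤ 1 := by
  apply LSeries.abscissaOfAbsConv_le_of_le_const
  refine ⟨1, fun n _ => ?_⟩
  rw [show 2 * (π : ℂ) * Complex.I * q * n = ((2 * π * q * n : ℝ) : ℂ) * Complex.I by
    push_cast; ring, Complex.norm_exp_ofReal_mul_I]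

lemma deriv_expZeta (q : ℝ) {s : ℂ} (hs : 1 < s.re) :
    deriv (HurwitzZeta.expZeta q) s = -LSeries (LSeries.logMul
      (fun n : ℕ => Complex.exp (2 * π * Complex.I * q * n))) s := by
  rw [← LSeries_deriv ((abscissaOfAbsConv_exp_le_one q).trans_lt (by exact_mod_cast hs))]
  apply Filter.EventuallyEq.deriv_eq
  filter_upwards [(isOpen_lt continuous_const Complex.continuous_re).mem_nhds hs] with z hz
  exact (HurwitzZeta.LSeriesHasSum_exp q hz).LSeries_eq.symm

lemma continuous_LSeries_exp {g : ℕ → ℂ} {s : ℂ} (hg : LSeriesSummable g s) :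
    Continuous fun q : ℝ => LSeries
      (fun n : ℕ => g n * Complex.exp (2 * π * Complex.I * q * n)) s := by
  refine continuous_tsum (fun n => ?_) hg.norm (fun n q => ?_)
  · rcases eq_or_ne n 0 with rfl | hn
    · simpa using continuous_const
    · simp only [LSeries.term_of_ne_zero hn]
      fun_prop
  · rcases eq_or_ne n 0 with rfl | hn
    · simp
    · rw [LSeries.term_of_ne_zero hn, LSeries.term_of_ne_zero hn, norm_div, norm_mul,
        show 2 * (π : ℂ) * Complex.I * q * n = ((2 * π * q * n : ℝ) : ℂ) * Complex.I by
        push_cast; ring, Complex.norm_exp_ofReal_mul_I, mul_one, norm_div]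

lemma continuous_expZeta {s : ℂ} (hs : 1 < s.re) :
    Continuous fun q : ℝ => HurwitzZeta.expZeta q s := by
  have h := continuous_LSeries_exp (LSeriesSummable_one_iff.mpr hs)
  convert h using 2 with q
  simpa using (HurwitzZeta.LSeriesHasSum_exp q hs).LSeries_eq.symm

lemma continuous_deriv_expZeta {s : ℂ} (hs : 1 < s.re) :
    Continuous fun q : ℝ => deriv (HurwitzZeta.expZeta q) s := by
  have h := continuous_LSeries_exp (g := LSeries.logMul 1) (s := s)
    (LSeriesSummable_logMul_of_lt_re (by
      rw [LSeries.abscissaOfAbsConv_one]; exact_mod_cast hs))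
  convert! h.neg using 2 with q
  rw [deriv_expZeta q hs]
  simp [LSeries.logMul]

/-- The derivative of the Hurwitz zeta function, through the functional equation. -/
lemma deriv_hurwitzZeta_one_sub (a : UnitAddCircle) {k : ℂ} (hk : 1 < k.re) :
    deriv (HurwitzZeta.hurwitzZeta a) (1 - k) =
      -(deriv (fun s : ℂ => (2 * π : ℂ) ^ (-s) * Complex.Gamma s) k *
          (Complex.exp (-π * Complex.I * k / 2) * HurwitzZeta.expZeta a k
            + Complex.exp (π * Complex.I * k / 2) * HurwitzZeta.expZeta (-a) k)
        + (2 * π : ℂ) ^ (-k) * Complex.Gamma k *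
          (-π * Complex.I / 2 * Complex.exp (-π * Complex.I * k / 2) * HurwitzZeta.expZeta a k
            + Complex.exp (-π * Complex.I * k / 2) * deriv (HurwitzZeta.expZeta a) k
            + (π * Complex.I / 2 * Complex.exp (π * Complex.I * k / 2)
              * HurwitzZeta.expZeta (-a) k
            + Complex.exp (π * Complex.I * k / 2) * deriv (HurwitzZeta.expZeta (-a)) k))) := by
  have hn {z : ℂ} (hz : 1 < z.re) (n : ℕ) : z ≠ -n := by
    rintro rfl
    simp only [Complex.neg_re, Complex.natCast_re] at hz
    have : (0 : ℝ) ≤ n := n.cast_nonneg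
    linarith
  have h1 {z : ℂ} (hz : 1 < z.re) : z ≠ 1 := by
    rintro rfl
    simp at hz
  have hpi : (2 * π : ℂ) ≠ 0 := by simp [pi_ne_zero]
  have dG : DifferentiableAt ℂ (fun s : ℂ => (2 * π : ℂ) ^ (-s) * Complex.Gamma s) k :=
    (differentiableAt_id.neg.const_cpow (Or.inl hpi)).mul
      (Complex.differentiableAt_Gamma k (hn hk))
  have dE (b : UnitAddCircle) := (HurwitzZeta.differentiableAt_expZeta b k
    (Or.inl (h1 hk))).hasDerivAt
  have de (c : ℂ) : HasDerivAt (fun s : ℂ => Complex.exp (c * Complex.I * s / 2))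
      (c * Complex.I / 2 * Complex.exp (c * Complex.I * k / 2)) k := by
    have : HasDerivAt (fun s : ℂ => c * Complex.I * s / 2) (c * Complex.I / 2) k := by
      simpa using ((hasDerivAt_id k).const_mul (c * Complex.I)).div_const 2
    simpa [mul_comm] using this.cexp
  have hR := dG.hasDerivAt.mul (((de (-π)).mul (dE a)).add ((de π).mul (dE (-a))))
  have hL : HasDerivAt (fun s => HurwitzZeta.hurwitzZeta a (1 - s))
      (-deriv (HurwitzZeta.hurwitzZeta a) (1 - k)) k := by
    have hk0 : (1 - k) ≠ 1 := by
      intro h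
      have := hn hk 0
      apply this
      simpa using h
    have := (HurwitzZeta.differentiableAt_hurwitzZeta a hk0).hasDerivAt.comp_const_sub 1 k
    simpa using this
  have he : (fun s => HurwitzZeta.hurwitzZeta a (1 - s)) =ᶠ[nhds k]
      fun s => (2 * π : ℂ) ^ (-s) * Complex.Gamma s *
        (Complex.exp (-π * Complex.I * s / 2) * HurwitzZeta.expZeta a s
          + Complex.exp (π * Complex.I * s / 2) * HurwitzZeta.expZeta (-a) s) := by
    filter_upwards [(isOpen_lt continuous_const Complex.continuous_re).mem_nhds hk] with z hz
    exact HurwitzZeta.hurwitzZeta_one_sub a (hn hz) (Or.inr (h1 hz))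
  have hu := hL.unique (hR.congr_of_eventuallyEq he)
  rw [eq_neg_iff_add_eq_zero, add_comm, ← eq_neg_iff_add_eq_zero]
  exact hu.symm

lemma continuous_A {k : ℕ} (hk : 2 ≤ k) : Continuous (A k) := by
  have hs : 1 < ((k : ℂ)).re := by
    rw [Complex.natCast_re]; exact_mod_cast hk
  have c1 := continuous_expZeta hs
  have c2 := continuous_deriv_expZeta hs
  have c3 : Continuous fun q : ℝ => HurwitzZeta.expZeta (-(q : UnitAddCircle)) (k : ℂ) := by
    simpa [Function.comp_def] using! c1.comp continuous_neg
  have c4 : Continuous fun q : ℝ => deriv (HurwitzZeta.expZeta (-(q : UnitAddCircle))) (k : ℂ) := by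
    simpa [Function.comp_def] using! c2.comp continuous_neg
  unfold A
  simp only [deriv_hurwitzZeta_one_sub _ hs]
  exact continuous_const.mul (Complex.continuous_re.comp (by fun_prop))

lemma A_one_sub (k : ℕ) (q : ℝ) :
    A k (1 - q) =
      k * (deriv (HurwitzZeta.hurwitzZeta (-(q : UnitAddCircle))) (1 - (k : ℂ))).re := by
  have : ((1 - q : ℝ) : UnitAddCircle) = -(q : UnitAddCircle) := by
    rw [sub_eq_add_neg, AddCircle.coe_add, AddCircle.coe_period, zero_add, AddCircle.coe_neg]
  rw [A, this]

lemma exp_pi_mul_I_mul_odd_div_two (l : ℕ) :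
    Complex.exp (π * Complex.I * ((2 * l + 1 : ℕ) : ℂ) / 2) = (-1) ^ l * Complex.I := by
  rw [show π * Complex.I * ((2 * l + 1 : ℕ) : ℂ) / 2 = l * (π * Complex.I) + π / 2 * Complex.I by
    push_cast; ring, Complex.exp_add, Complex.exp_nat_mul, Complex.exp_pi_mul_I,
    Complex.exp_pi_div_two_mul_I]

lemma exp_pi_mul_I_mul_even_div_two (l : ℕ) :
    Complex.exp (π * Complex.I * ((2 * l : ℕ) : ℂ) / 2) = (-1) ^ l := by
  rw [show π * Complex.I * ((2 * l : ℕ) : ℂ) / 2 = l * (π * Complex.I) by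
    push_cast; ring, Complex.exp_nat_mul, Complex.exp_pi_mul_I]

lemma exp_neg_pi_mul_I_mul_div_two (k : ℂ) :
    Complex.exp (-π * Complex.I * k / 2) = (Complex.exp (π * Complex.I * k / 2))⁻¹ := by
  rw [← Complex.exp_neg]; congr 1; ring

/-- The periodic cosine series `∑ cos (2 π n q) / n ^ k`. -/
noncomputable def cosSeries (k : ℕ) (q : ℝ) : ℝ := ∑' n : ℕ, 1 / (n : ℝ) ^ k * cos (2 * π * n * q)

/-- The periodic sine series `∑ sin (2 π n q) / n ^ k`. -/
noncomputable def sinSeries (k : ℕ) (q : ℝ) : ℝ := ∑' n : ℕ, 1 / (n : ℝ) ^ k * sin (2 * π * n * q)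

lemma summable_one_div_pow_mul {k : ℕ} (hk : 2 ≤ k) {f : ℕ → ℝ} (hf : ∀ n, |f n| ≤ 1) :
    Summable fun n : ℕ => 1 / (n : ℝ) ^ k * f n := by
  refine Summable.of_norm_bounded (Real.summable_one_div_nat_pow.mpr hk) fun n => ?_
  rw [norm_mul, Real.norm_of_nonneg (by positivity)]
  exact mul_le_of_le_one_right (by positivity) (hf n)

lemma hasSum_cosSeries {k : ℕ} (hk : 2 ≤ k) (q : ℝ) :
    HasSum (fun n : ℕ => 1 / (n : ℝ) ^ k * cos (2 * π * n * q)) (cosSeries k q) :=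
  (summable_one_div_pow_mul hk fun _ => abs_cos_le_one _).hasSum

lemma hasSum_sinSeries {k : ℕ} (hk : 2 ≤ k) (q : ℝ) :
    HasSum (fun n : ℕ => 1 / (n : ℝ) ^ k * sin (2 * π * n * q)) (sinSeries k q) :=
  (summable_one_div_pow_mul hk fun _ => abs_sin_le_one _).hasSum

lemma cosZeta_natCast {k : ℕ} (hk : 2 ≤ k) (q : ℝ) :
    HurwitzZeta.cosZeta q k = (cosSeries k q : ℂ) := by
  have hs : 1 < ((k : ℂ)).re := by
    rw [Complex.natCast_re]; exact_mod_cast hk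
  refine (HurwitzZeta.hasSum_nat_cosZeta q hs).unique ?_
  convert Complex.hasSum_ofReal.mpr (hasSum_cosSeries hk q) using 2 with n
  rw [Complex.cpow_natCast]
  push_cast
  rw [div_mul_eq_mul_div, one_mul, mul_right_comm _ (q : ℂ)]

lemma sinZeta_natCast {k : ℕ} (hk : 2 ≤ k) (q : ℝ) :
    HurwitzZeta.sinZeta q k = (sinSeries k q : ℂ) := by
  have hs : 1 < ((k : ℂ)).re := by
    rw [Complex.natCast_re]; exact_mod_cast hk
  refine (HurwitzZeta.hasSum_nat_sinZeta q hs).unique ?_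
  convert Complex.hasSum_ofReal.mpr (hasSum_sinSeries hk q) using 2 with n
  rw [Complex.cpow_natCast]
  push_cast
  rw [div_mul_eq_mul_div, one_mul, mul_right_comm _ (q : ℂ)]

lemma two_pi_cpow_neg_mul_Gamma (k : ℕ) :
    (2 * π : ℂ) ^ (-((k + 1 : ℕ) : ℂ)) * Complex.Gamma (k + 1 : ℕ)
      = ((k.factorial / (2 * π) ^ (k + 1) : ℝ) : ℂ) := by
  rw [Complex.cpow_neg, Complex.cpow_natCast, Nat.cast_succ k, Complex.Gamma_nat_eq_factorial]
  push_cast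
  ring

lemma A_odd_add_A_one_sub {l : ℕ} (hl : 1 ≤ l) (q : ℝ) :
    A (2 * l + 1) q + A (2 * l + 1) (1 - q) =
      2 * (π * (-1) ^ l * (2 * l + 1).factorial / (2 * π) ^ (2 * l + 1)
        * cosSeries (2 * l + 1) q) := by
  have hs : 1 < (((2 * l + 1 : ℕ) : ℂ)).re := by
    rw [Complex.natCast_re]; exact_mod_cast (by omega : 1 < 2 * l + 1)
  rw [A_one_sub, A, ← mul_add, ← Complex.add_re]
  have key : deriv (HurwitzZeta.hurwitzZeta (q : UnitAddCircle)) (1 - ((2 * l + 1 : ℕ) : ℂ))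
      + deriv (HurwitzZeta.hurwitzZeta (-(q : UnitAddCircle))) (1 - ((2 * l + 1 : ℕ) : ℂ))
      = ((2 * π * (-1) ^ l * (((2 * l).factorial / (2 * π) ^ (2 * l + 1) : ℝ))
        * cosSeries (2 * l + 1) q : ℝ) : ℂ) := by
    have hc := cosZeta_natCast (show 2 ≤ 2 * l + 1 by omega) q
    rw [HurwitzZeta.cosZeta_eq, div_eq_iff two_ne_zero] at hc
    rw [deriv_hurwitzZeta_one_sub _ hs, deriv_hurwitzZeta_one_sub _ hs, neg_neg,
      two_pi_cpow_neg_mul_Gamma, exp_neg_pi_mul_I_mul_div_two, exp_pi_mul_I_mul_odd_div_two,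
      mul_inv, Complex.inv_I, ← inv_pow, inv_neg_one]
    generalize ((2 * l).factorial / (2 * π) ^ (2 * l + 1) : ℝ) = g
    push_cast at hc ⊢
    linear_combination g * π * (-1) ^ l * hc - g * π * (-1) ^ l *
      (HurwitzZeta.expZeta q (2 * l + 1) + HurwitzZeta.expZeta (-q) (2 * l + 1)) * Complex.I_sq
  rw [key, Complex.ofReal_re, Nat.factorial_succ]
  push_cast
  ring

lemma A_even_sub_A_one_sub {l : ℕ} (hl : 1 ≤ l) (q : ℝ) :
    A (2 * l) q - A (2 * l) (1 - q) =
      2 * (-(π * (-1) ^ l * (2 * l).factorial / (2 * π) ^ (2 * l)) * sinSeries (2 * l) q) := by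
  have hs : 1 < (((2 * l : ℕ) : ℂ)).re := by
    rw [Complex.natCast_re]; exact_mod_cast (by omega : 1 < 2 * l)
  rw [A_one_sub, A, ← mul_sub, ← Complex.sub_re]
  obtain ⟨t, ht⟩ : ∃ t, 2 * l = t + 1 := ⟨2 * l - 1, by omega⟩
  have key : deriv (HurwitzZeta.hurwitzZeta (q : UnitAddCircle)) (1 - ((2 * l : ℕ) : ℂ))
      - deriv (HurwitzZeta.hurwitzZeta (-(q : UnitAddCircle))) (1 - ((2 * l : ℕ) : ℂ))
      = ((-(2 * π * (-1) ^ l * ((t.factorial / (2 * π) ^ (t + 1) : ℝ)))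
        * sinSeries (2 * l) q : ℝ) : ℂ) := by
    have hc := sinZeta_natCast (show 2 ≤ 2 * l by omega) q
    rw [HurwitzZeta.sinZeta_eq, div_eq_iff (by simp)] at hc
    rw [deriv_hurwitzZeta_one_sub _ hs, deriv_hurwitzZeta_one_sub _ hs, neg_neg,
      exp_neg_pi_mul_I_mul_div_two, exp_pi_mul_I_mul_even_div_two, ← inv_pow, inv_neg_one]
    rw [show (2 * π : ℂ) ^ (-((2 * l : ℕ) : ℂ)) * Complex.Gamma (2 * l : ℕ)
      = ((t.factorial / (2 * π) ^ (t + 1) : ℝ) : ℂ) by rw [ht, two_pi_cpow_neg_mul_Gamma]]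
    generalize (t.factorial / (2 * π) ^ (t + 1) : ℝ) = g
    push_cast at hc ⊢
    linear_combination g * π * (-1) ^ l * Complex.I * hc
      + 2 * g * π * (-1) ^ l * sinSeries (2 * l) q * Complex.I_sq
  rw [key, Complex.ofReal_re, ht, Nat.factorial_succ]
  push_cast
  ring

lemma continuous_B (k : ℕ) : Continuous (B k) := by
  unfold B
  fun_prop

lemma B_even {j : ℕ} (hj : 1 ≤ j) {q : ℝ} (hq : q ∈ Set.Icc (0 : ℝ) 1) :
    B (2 * j) q = 2 * (-1) ^ (j + 1) * (2 * j).factorial / (2 * π) ^ (2 * j)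
      * cosSeries (2 * j) q := by
  have h := (hasSum_cosSeries (show 2 ≤ 2 * j by omega) q).unique
    (hasSum_one_div_nat_pow_mul_cos (by omega) hq)
  rw [h, B, Polynomial.eval_map_algebraMap]
  have : ((-1 : ℝ) ^ (j + 1)) * (-1) ^ (j + 1) = 1 := by rw [← mul_pow]; simp
  have h1 : ((2 * j).factorial : ℝ) ≠ 0 := by positivity
  field_simp
  linear_combination (-Polynomial.aeval q (Polynomial.bernoulli (2 * j))) * this

lemma B_odd {j : ℕ} (hj : 1 ≤ j) {q : ℝ} (hq : q ∈ Set.Icc (0 : ℝ) 1) :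
    B (2 * j + 1) q = 2 * (-1) ^ (j + 1) * (2 * j + 1).factorial / (2 * π) ^ (2 * j + 1)
      * sinSeries (2 * j + 1) q := by
  have h := (hasSum_sinSeries (show 2 ≤ 2 * j + 1 by omega) q).unique
    (hasSum_one_div_nat_pow_mul_sin (by omega) hq)
  rw [h, B, Polynomial.eval_map_algebraMap]
  have : ((-1 : ℝ) ^ (j + 1)) * (-1) ^ (j + 1) = 1 := by rw [← mul_pow]; simp
  have h1 : ((2 * j + 1).factorial : ℝ) ≠ 0 := by positivity
  field_simp
  linear_combination (-Polynomial.aeval q (Polynomial.bernoulli (2 * j + 1))) * this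

lemma cosSeries_one_sub (k : ℕ) (q : ℝ) : cosSeries k (1 - q) = cosSeries k q := by
  unfold cosSeries
  congr 1 with n
  rw [show 2 * π * n * (1 - q) = n * (2 * π) - 2 * π * n * q by ring, cos_nat_mul_two_pi_sub]

lemma sinSeries_one_sub (k : ℕ) (q : ℝ) : sinSeries k (1 - q) = -sinSeries k q := by
  unfold sinSeries
  rw [← tsum_neg]
  congr 1 with n
  rw [show 2 * π * n * (1 - q) = n * (2 * π) - 2 * π * n * q by ring, sin_nat_mul_two_pi_sub]
  ring

lemma K_one_sub (q : ℝ) : K (1 - q) = K q := by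
  rw [K, K, show π * (1 - q) = π - π * q by ring, sin_pi_sub]

lemma two_mul_integral_eq_integral_add_one_sub {f : ℝ → ℝ}
    (hf : IntervalIntegrable f volume 0 1) :
    2 * ∫ q in (0:ℝ)..1, f q = ∫ q in (0:ℝ)..1, (f q + f (1 - q)) := by
  have h1 : IntervalIntegrable (fun q => f (1 - q)) volume 0 1 := by
    simpa using (hf.comp_sub_left 1).symm
  rw [intervalIntegral.integral_add hf h1, intervalIntegral.integral_comp_sub_left f 1]
  simp
  ring

lemma intervalIntegrable_A_mul_B_mul_K {k : ℕ} (hk : 2 ≤ k) (l : ℕ) :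
    IntervalIntegrable (fun q => A k q * B l q * K q) volume 0 1 :=
  intervalIntegrable_mul_K ((continuous_A hk).mul (continuous_B l))

lemma integral_A_odd_mul_B_even_mul_K {l j : ℕ} (hl : 1 ≤ l) (hj : 1 ≤ j) :
    ∫ q in (0:ℝ)..1, A (2 * l + 1) q * B (2 * j) q * K q =
      π * (-1) ^ l * (2 * l + 1).factorial / (2 * π) ^ (2 * l + 1) *
      (2 * (-1) ^ (j + 1) * (2 * j).factorial / (2 * π) ^ (2 * j)) *
      ∫ q in (0:ℝ)..1, cosSeries (2 * j) q * cosSeries (2 * l + 1) q * K q := by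
  apply mul_left_cancel₀ (two_ne_zero (α := ℝ))
  rw [two_mul_integral_eq_integral_add_one_sub
    (intervalIntegrable_A_mul_B_mul_K (by omega) _), ← intervalIntegral.integral_const_mul,
    ← intervalIntegral.integral_const_mul]
  refine intervalIntegral.integral_congr fun q hq => ?_
  rw [Set.uIcc_of_le zero_le_one] at hq
  have hq' : 1 - q ∈ Set.Icc (0 : ℝ) 1 := ⟨by linarith [hq.2], by linarith [hq.1]⟩
  have h := A_odd_add_A_one_sub hl q
  simp only [K_one_sub, B_even hj hq, B_even hj hq', cosSeries_one_sub]
  linear_combination 2 * (-1) ^ (j + 1) * (2 * j).factorial / (2 * π) ^ (2 * j)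
      * cosSeries (2 * j) q * K q * h

lemma integral_A_even_mul_B_odd_mul_K {l j : ℕ} (hl : 1 ≤ l) (hj : 1 ≤ j) :
    ∫ q in (0:ℝ)..1, A (2 * l) q * B (2 * j + 1) q * K q =
      -(π * (-1) ^ l * (2 * l).factorial / (2 * π) ^ (2 * l)) *
      (2 * (-1) ^ (j + 1) * (2 * j + 1).factorial / (2 * π) ^ (2 * j + 1)) *
      ∫ q in (0:ℝ)..1, sinSeries (2 * j + 1) q * sinSeries (2 * l) q * K q := by
  apply mul_left_cancel₀ (two_ne_zero (α := ℝ))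
  rw [two_mul_integral_eq_integral_add_one_sub
    (intervalIntegrable_A_mul_B_mul_K (by omega) _), ← intervalIntegral.integral_const_mul,
    ← intervalIntegral.integral_const_mul]
  refine intervalIntegral.integral_congr fun q hq => ?_
  rw [Set.uIcc_of_le zero_le_one] at hq
  have hq' : 1 - q ∈ Set.Icc (0 : ℝ) 1 := ⟨by linarith [hq.2], by linarith [hq.1]⟩
  have h := A_even_sub_A_one_sub hl q
  simp only [K_one_sub, B_odd hj hq, B_odd hj hq', sinSeries_one_sub]
  linear_combination 2 * (-1) ^ (j + 1) * (2 * j + 1).factorial / (2 * π) ^ (2 * j + 1)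
      * sinSeries (2 * j + 1) q * K q * h

lemma one_div_natCast_pow (n k : ℕ) (hk : 1 ≤ k) :
    1 / (n : ℝ) ^ k = n * (1 / (n : ℝ) ^ (k + 1)) := by
  rcases eq_or_ne n 0 with rfl | hn
  · simp [show k ≠ 0 by omega]
  · have : (n : ℝ) ≠ 0 := by exact_mod_cast hn
    rw [pow_succ]
    field_simp

lemma summable_mul_one_div_pow {j l : ℕ} (hj : 2 ≤ j) (hl : 2 ≤ l) :
    Summable fun p : ℕ × ℕ => 1 / (p.1 : ℝ) ^ j * (1 / (p.2 : ℝ) ^ l) :=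
  (Real.summable_one_div_nat_pow.mpr hj).mul_of_nonneg (Real.summable_one_div_nat_pow.mpr hl)
    (fun _ => by positivity) (fun _ => by positivity)

lemma hasSum_prod_cosSeries {j l : ℕ} (hj : 2 ≤ j) (hl : 2 ≤ l) (q : ℝ) :
    HasSum (fun p : ℕ × ℕ => (1 / (p.1 : ℝ) ^ j * cos (2 * π * p.1 * q)) *
      (1 / (p.2 : ℝ) ^ l * cos (2 * π * p.2 * q))) (cosSeries j q * cosSeries l q) := by
  have h1 := hasSum_cosSeries hj q
  have h2 := hasSum_cosSeries hl q
  have h3 := summable_mul_of_summable_norm h1.summable.norm h2.summable.norm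
  exact h1.mul h2 h3

lemma hasSum_prod_sinSeries {j l : ℕ} (hj : 2 ≤ j) (hl : 2 ≤ l) (q : ℝ) :
    HasSum (fun p : ℕ × ℕ => (1 / (p.1 : ℝ) ^ j * sin (2 * π * p.1 * q)) *
      (1 / (p.2 : ℝ) ^ l * sin (2 * π * p.2 * q))) (sinSeries j q * sinSeries l q) := by
  have h1 := hasSum_sinSeries hj q
  have h2 := hasSum_sinSeries hl q
  have h3 := summable_mul_of_summable_norm h1.summable.norm h2.summable.norm
  exact h1.mul h2 h3

lemma hasSum_integral_cosSeries_sub_sinSeries {j l : ℕ} (hj : 2 ≤ j) (hl : 2 ≤ l) :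
    HasSum (fun p : ℕ × ℕ => 1 / (p.1 : ℝ) ^ (j + 1) * (1 / (p.2 : ℝ) ^ (l + 1)) *
        (-(1 + (((p.1 : ℤ) - p.2).sign : ℝ)) / 4))
      (∫ q in (0:ℝ)..1, (cosSeries j q * cosSeries (l + 1) q
        - sinSeries (j + 1) q * sinSeries l q) * K q) := by
  have hsum : Summable fun p : ℕ × ℕ => 1 / (p.1 : ℝ) ^ j * (1 / (p.2 : ℝ) ^ (l + 1))
      + 1 / (p.1 : ℝ) ^ (j + 1) * (1 / (p.2 : ℝ) ^ l) :=
    (summable_mul_one_div_pow hj (by omega)).add (summable_mul_one_div_pow (by omega) hl)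
  have key := intervalIntegral.hasSum_integral_of_dominated_convergence (μ := volume)
    (a := 0) (b := 1)
    (F := fun (p : ℕ × ℕ) q => ((1 / (p.1 : ℝ) ^ j * cos (2 * π * p.1 * q)) *
        (1 / (p.2 : ℝ) ^ (l + 1) * cos (2 * π * p.2 * q)) -
      (1 / (p.1 : ℝ) ^ (j + 1) * sin (2 * π * p.1 * q)) *
        (1 / (p.2 : ℝ) ^ l * sin (2 * π * p.2 * q))) * K q)
    (f := fun q => (cosSeries j q * cosSeries (l + 1) q
        - sinSeries (j + 1) q * sinSeries l q) * K q)
    (fun p q => (1 / (p.1 : ℝ) ^ j * (1 / (p.2 : ℝ) ^ (l + 1))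
      + 1 / (p.1 : ℝ) ^ (j + 1) * (1 / (p.2 : ℝ) ^ l)) * |K q|) ?_ ?_ ?_ ?_ ?_
  · refine key.congr_fun fun p => ?_
    obtain ⟨r, s⟩ := p
    dsimp only
    rcases Nat.eq_zero_or_pos (r + s) with h | h
    · obtain rfl : r = 0 := by omega
      simp [show j ≠ 0 by omega]
    · rw [← cos_cos_sub_sin_sin_moment_K r s h, ← intervalIntegral.integral_const_mul]
      congr 1
      ext q
      rw [one_div_natCast_pow r j (by omega), one_div_natCast_pow s l (by omega)]
      ring
  · intro p
    exact (intervalIntegrable_mul_K (f := fun q => _) (by fun_prop)).def'.aestronglyMeasurable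
  · refine fun p => Filter.Eventually.of_forall fun q _ => ?_
    rw [norm_mul, Real.norm_eq_abs (K q)]
    refine mul_le_mul_of_nonneg_right ((norm_sub_le _ _).trans (add_le_add ?_ ?_)) (abs_nonneg _)
    · rw [norm_mul, norm_mul, norm_mul, Real.norm_of_nonneg (by positivity : 0 ≤ 1 / (p.1 : ℝ) ^ j),
        Real.norm_of_nonneg (by positivity : 0 ≤ 1 / (p.2 : ℝ) ^ (l + 1))]
      gcongr
      · exact mul_le_of_le_one_right (by positivity) (abs_cos_le_one _)
      · exact mul_le_of_le_one_right (by positivity) (abs_cos_le_one _)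
    · rw [norm_mul, norm_mul, norm_mul,
        Real.norm_of_nonneg (by positivity : 0 ≤ 1 / (p.1 : ℝ) ^ (j + 1)),
        Real.norm_of_nonneg (by positivity : 0 ≤ 1 / (p.2 : ℝ) ^ l)]
      gcongr
      · exact mul_le_of_le_one_right (by positivity) (abs_sin_le_one _)
      · exact mul_le_of_le_one_right (by positivity) (abs_sin_le_one _)
  · exact Filter.Eventually.of_forall fun q _ => hsum.mul_right _
  · simp only [tsum_mul_right]
    exact intervalIntegrable_K.abs.const_mul _
  · exact Filter.Eventually.of_forall fun q _ =>
      ((hasSum_prod_cosSeries hj (by omega) q).sub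
        (hasSum_prod_sinSeries (by omega) hl q)).mul_right _

lemma hasSum_rzeta {k : ℕ} (hk : 2 ≤ k) : HasSum (fun n : ℕ => 1 / (n : ℝ) ^ k) (rzeta k) := by
  have h : rzeta k = ∑' n : ℕ, 1 / (n : ℝ) ^ k := by
    rw [rzeta, Complex.ofReal_natCast, zeta_nat_eq_tsum_of_gt_one (by omega),
      ← Complex.ofReal_re (∑' n : ℕ, 1 / (n : ℝ) ^ k)]
    push_cast
    rfl
  rw [h]
  exact (Real.summable_one_div_nat_pow.mpr hk).hasSum

lemma T_eq_of_hasSum {m n : ℕ} (hm : m ≠ 0) {x : ℝ}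
    (h : HasSum (fun p : ℕ × ℕ =>
      if p.1 < p.2 then 1 / (p.1 : ℝ) ^ m * (1 / (p.2 : ℝ) ^ n) else 0) x) :
    T m 0 n = x := by
  let φ : ℕ+ × ℕ+ → ℕ × ℕ := fun p => (p.1, p.1 + p.2)
  have hφ : Function.Injective φ := by
    rintro ⟨a, b⟩ ⟨c, d⟩ h
    simp only [φ, Prod.mk.injEq, PNat.coe_inj] at h
    obtain ⟨rfl, h⟩ := h
    simpa using h
  rw [← hφ.hasSum_iff] at h
  · rw [← h.tsum_eq, h.summable.tsum_prod, T]
    refine tsum_congr fun r => tsum_congr fun s => ?_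
    simp [φ, ← Nat.cast_add, mul_comm]
  · rintro ⟨a, b⟩ hab
    rcases Nat.eq_zero_or_pos a with rfl | ha
    · simp [hm]
    · refine if_neg fun hlt => hab ⟨(⟨a, ha⟩, ⟨b - a, Nat.sub_pos_of_lt hlt⟩), ?_⟩
      simp only [φ, PNat.mk_coe, Prod.mk.injEq, true_and]
      exact Nat.add_sub_cancel' hlt.le

lemma T_eq_rzeta_add_integral {j l : ℕ} (hj : 2 ≤ j) (hl : 2 ≤ l) :
    T (j + 1 : ℕ) 0 (l + 1 : ℕ) = rzeta (j + 1 : ℕ) * rzeta (l + 1 : ℕ)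
      - 1 / 2 * rzeta (j + 1 + (l + 1) : ℕ)
      + 2 * ∫ q in (0:ℝ)..1, (cosSeries j q * cosSeries (l + 1) q
        - sinSeries (j + 1) q * sinSeries l q) * K q := by
  apply T_eq_of_hasSum (by omega)
  have h1 := (hasSum_rzeta (show 2 ≤ j + 1 by omega)).mul (hasSum_rzeta (show 2 ≤ l + 1 by omega))
    (summable_mul_one_div_pow (by omega) (by omega))
  have hd : Function.Injective fun n : ℕ => (n, n) := fun a b h => (Prod.mk.inj h).1
  have h2 : HasSum (fun p : ℕ × ℕ => if p.1 = p.2 then 1 / (p.1 : ℝ) ^ (j + 1 + (l + 1)) else 0)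
      (rzeta (j + 1 + (l + 1) : ℕ)) := by
    rw [← hd.hasSum_iff]
    · simpa [Function.comp_def] using hasSum_rzeta (show 2 ≤ j + 1 + (l + 1) by omega)
    · rintro ⟨a, b⟩ hab
      refine if_neg fun h : a = b => hab ⟨a, ?_⟩
      rw [h]
  refine ((h1.sub (h2.mul_left (1 / 2))).add
    ((hasSum_integral_cosSeries_sub_sinSeries hj hl).mul_left 2)).congr_fun fun p => ?_
  obtain ⟨r, s⟩ := p
  dsimp only
  rcases lt_trichotomy r s with h | rfl | h
  · rw [if_pos h, if_neg h.ne, Int.sign_eq_neg_one_of_neg (by omega)]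
    push_cast; ring
  · simp [pow_add]
    ring
  · rw [if_neg (by omega), if_neg (by omega), Int.sign_eq_one_of_pos (by omega)]
    push_cast; ring

lemma continuous_cosSeries {k : ℕ} (hk : 2 ≤ k) : Continuous (cosSeries k) := by
  refine continuous_tsum (fun n => by fun_prop) (Real.summable_one_div_nat_pow.mpr hk)
    fun n q => ?_
  rw [norm_mul, Real.norm_of_nonneg (by positivity)]
  exact mul_le_of_le_one_right (by positivity) (abs_cos_le_one _)

lemma continuous_sinSeries {k : ℕ} (hk : 2 ≤ k) : Continuous (sinSeries k) := by
  refine continuous_tsum (fun n => by fun_prop) (Real.summable_one_div_nat_pow.mpr hk)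
    fun n q => ?_
  rw [norm_mul, Real.norm_of_nonneg (by positivity)]
  exact mul_le_of_le_one_right (by positivity) (abs_sin_le_one _)

theorem tornheim_T_m_0_n_odd_odd (m n : ℕ) (hm : 2 ≤ m) (hn : 2 ≤ n)
    (hmo : Odd m) (hno : Odd n) :
    T m 0 n = rzeta m * rzeta n - (1 / 2) * rzeta (m + n) +
      (-1 : ℝ) ^ ((m + n) / 2) * ((2 * π) ^ (m + n - 1) / (m.factorial * n.factorial)) *
        (m * I_AB n (m - 1) + n * I_AB (n - 1) m) := by
  obtain ⟨j, rfl⟩ := hmo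
  obtain ⟨l, rfl⟩ := hno
  have hj : 1 ≤ j := by omega
  have hl : 1 ≤ l := by omega
  rw [T_eq_rzeta_add_integral (show 2 ≤ 2 * j by omega) (show 2 ≤ 2 * l by omega),
    ← Nat.cast_add (2 * j + 1) (2 * l + 1)]
  congr 1
  have hint : ∫ q in (0:ℝ)..1, (cosSeries (2 * j) q * cosSeries (2 * l + 1) q
        - sinSeries (2 * j + 1) q * sinSeries (2 * l) q) * K q =
      (∫ q in (0:ℝ)..1, cosSeries (2 * j) q * cosSeries (2 * l + 1) q * K q)
      - ∫ q in (0:ℝ)..1, sinSeries (2 * j + 1) q * sinSeries (2 * l) q * K q := by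
    rw [← intervalIntegral.integral_sub]
    · simp only [sub_mul]
    · exact intervalIntegrable_mul_K
        ((continuous_cosSeries (by omega)).mul (continuous_cosSeries (by omega)))
    · exact intervalIntegrable_mul_K
        ((continuous_sinSeries (by omega)).mul (continuous_sinSeries (by omega)))
  rw [hint, I_AB, I_AB, Nat.add_sub_cancel, Nat.add_sub_cancel,
    integral_A_odd_mul_B_even_mul_K hl hj, integral_A_even_mul_B_odd_mul_K hl hj,
    show (2 * j + 1 + (2 * l + 1)) / 2 = j + l + 1 by omega,
    show 2 * j + 1 + (2 * l + 1) - 1 = 2 * j + 2 * l + 1 by omega,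
    Nat.factorial_succ (2 * j), Nat.factorial_succ (2 * l)]
  generalize ∫ q in (0:ℝ)..1, cosSeries (2 * j) q * cosSeries (2 * l + 1) q * K q = X
  generalize ∫ q in (0:ℝ)..1, sinSeries (2 * j + 1) q * sinSeries (2 * l) q * K q = Y
  have hp := pi_ne_zero
  have h1 : ((2 * j).factorial : ℝ) ≠ 0 := by positivity
  have h2 : ((2 * l).factorial : ℝ) ≠ 0 := by positivity
  have h3 : ((2 * j + 1 : ℕ) : ℝ) ≠ 0 := by positivity
  have h4 : ((2 * l + 1 : ℕ) : ℝ) ≠ 0 := by positivity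
  have ej : ((-1 : ℝ) ^ j) * (-1) ^ j = 1 := by rw [← mul_pow]; simp
  have el : ((-1 : ℝ) ^ l) * (-1) ^ l = 1 := by rw [← mul_pow]; simp
  generalize hA : (-1 : ℝ) ^ j = a at ej
  generalize hB : (-1 : ℝ) ^ l = b at el
  have ea : (-1 : ℝ) ^ (j + 1) = -a := by rw [pow_succ, hA]; ring
  have eb : (-1 : ℝ) ^ (j + l + 1) = -(a * b) := by rw [pow_succ, pow_add, hA, hB]; ring
  rw [ea, eb]
  push_cast at h3 h4 ⊢
  field_simp
  rw [pow_succ (2 * π) (2 * j + 2 * l), pow_succ (2 * π) (2 * l), pow_succ (2 * π) (2 * j),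
    pow_add]
  linear_combination (-((X - Y) * ((2 * π) ^ (2 * l) * (2 * π) ^ (2 * j) * (2 * π)) ^ 2)) *
    (b ^ 2 * ej + el)
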